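/- Suppose the BFGS initialization satisfies ‖x_0 − x_*‖ ≤ (μ^{3/2}/(M√L))·min{ε, δ/√d} and H_0 = ∇²f(x_0)^{-1}, where ε, δ > 0 are such that for some r ∈ (0, 1) both [(2δ + 1)·4(1 + 2ε² + ε³)/(1 − ε)² + (3 + 2ε)/(1 − ε)]·ε/(1 − r) ≤ δ and (2δ + 1)ε + 2δ ≤ r. Then for every k ≥ 1 the BFGS iterates satisfy ‖x_k − x_*‖ ≤ √(L/μ)·( (2√2·δ·((1 + ε)(1 + r)/((1 − ε)(1 − r)))·√k + (1 + ε)ε(1 + r)/((1 − ε)²(1 − r)²)) / k )^k · ‖x_0 − x_*‖. -/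

import Mathlib

noncomputable section

open Matrix Finset

abbrev E (d : ℕ) := EuclideanSpace ℝ (Fin d)
abbrev Mat (d : ℕ) := Matrix (Fin d) (Fin d) ℝ

/-- Spectral (operator 2-) norm of a real matrix. -/
def spec {d : ℕ} (A : Mat d) : ℝ := ‖Matrix.toEuclideanCLM (𝕜 := ℝ) A‖

/-- Frobenius norm of a real matrix. -/
def frob {d : ℕ} (A : Mat d) : ℝ := Real.sqrt (∑ i, ∑ j, (A i j) ^ 2)

/-- A matrix acting on a Euclidean vector. -/
def mApp {d : ℕ} (A : Mat d) (v : E d) : E d := Matrix.toEuclideanCLM (𝕜 := ℝ) A v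

/-- Outer product `u vᵀ`. -/
def outer {d : ℕ} (u v : E d) : Mat d := Matrix.of fun i j => u i * v j

/-- Euclidean dot product. -/
def dot {d : ℕ} (u v : E d) : ℝ := ∑ i, u i * v i

/-- `σ(x) = (M/μ^{3/2})·‖H_*^{1/2}(x − x_*)‖`. -/
def sig {d : ℕ} (M μ : ℝ) (sqH : Mat d) (xs x : E d) : ℝ :=
  M / μ ^ ((3:ℝ)/2) * ‖mApp sqH (x - xs)‖

/-- The BFGS update of the inverse Hessian approximation. -/
def bfgsUpdate {d : ℕ} (H : Mat d) (s y : E d) : Mat d :=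
  (1 - (dot y s)⁻¹ • outer s y) * H * (1 - (dot s y)⁻¹ • outer y s)
    + (dot y s)⁻¹ • outer s s


section MatrixLemmas

variable {d : ℕ}

lemma mApp_apply (A : Mat d) (v : E d) (i : Fin d) : mApp A v i = ∑ j, A i j * v j := rfl

lemma mApp_mul (A B : Mat d) (v : E d) : mApp (A * B) v = mApp A (mApp B v) := by
  simp [mApp]

lemma mApp_one (v : E d) : mApp 1 v = v := by
  simp [mApp]

lemma mApp_sub_left (A B : Mat d) (v : E d) : mApp (A - B) v = mApp A v - mApp B v := by
  simp [mApp]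

lemma mApp_add (A : Mat d) (u v : E d) : mApp A (u + v) = mApp A u + mApp A v := by
  simp [mApp]

lemma mApp_sub (A : Mat d) (u v : E d) : mApp A (u - v) = mApp A u - mApp A v := by
  simp [mApp]

lemma dot_eq_inner (u v : E d) : dot u v = inner ℝ u v := by
  simp [dot, PiLp.inner_apply, mul_comm]

lemma dot_comm (u v : E d) : dot u v = dot v u := by
  simp [dot, mul_comm]

lemma dot_self (u : E d) : dot u u = ‖u‖ ^ 2 := by
  rw [dot_eq_inner, real_inner_self_eq_norm_sq]

lemma dot_mApp_left (A : Mat d) (u v : E d) : dot (mApp A u) v = dot u (mApp Aᵀ v) := by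
  simp only [dot, mApp_apply, Finset.sum_mul, Finset.mul_sum, Matrix.transpose_apply]
  rw [Finset.sum_comm]
  exact Finset.sum_congr rfl fun i _ => Finset.sum_congr rfl fun j _ => by ring

lemma mul_outer (A : Mat d) (u v : E d) : A * outer u v = outer (mApp A u) v := by
  ext i j
  simp [outer, Matrix.mul_apply, mApp_apply, Finset.sum_mul, mul_assoc]

lemma outer_mul (A : Mat d) (u v : E d) : outer u v * A = outer u (mApp Aᵀ v) := by
  ext i j
  simp only [outer, Matrix.mul_apply, Matrix.of_apply, mApp_apply, Finset.mul_sum,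
    Matrix.transpose_apply]
  exact Finset.sum_congr rfl fun k _ => by ring

lemma outer_mul_outer (u v w z : E d) : outer u v * outer w z = dot v w • outer u z := by
  ext i j
  simp only [outer, Matrix.mul_apply, Matrix.of_apply, Matrix.smul_apply, smul_eq_mul, dot,
    Finset.sum_mul]
  exact Finset.sum_congr rfl fun k _ => by ring

lemma outer_transpose (u v : E d) : (outer u v)ᵀ = outer v u := by
  ext i j
  simp [outer, mul_comm]

lemma frob_nonneg (A : Mat d) : 0 ≤ frob A := Real.sqrt_nonneg _

lemma frob_sq (A : Mat d) : frob A ^ 2 = ∑ i, ∑ j, A i j ^ 2 :=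
  Real.sq_sqrt (by positivity)

lemma frob_transpose (A : Mat d) : frob Aᵀ = frob A := by
  simp only [frob, Matrix.transpose_apply]
  rw [Finset.sum_comm]

section FrobeniusInstance

attribute [local instance] Matrix.frobeniusNormedAddCommGroup

lemma frob_eq_norm (A : Mat d) : frob A = ‖A‖ := by
  simp [frob, Matrix.frobenius_norm_def, Real.sqrt_eq_rpow]

lemma frob_add_le (A B : Mat d) : frob (A + B) ≤ frob A + frob B := by
  simpa only [frob_eq_norm] using norm_add_le A B

end FrobeniusInstance

lemma norm_mApp_le_frob (A : Mat d) (v : E d) : ‖mApp A v‖ ≤ frob A * ‖v‖ := by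
  refine le_of_sq_le_sq ?_ (mul_nonneg (frob_nonneg A) (norm_nonneg v))
  rw [mul_pow, frob_sq, EuclideanSpace.real_norm_sq_eq, EuclideanSpace.real_norm_sq_eq,
    Finset.sum_mul]
  exact Finset.sum_le_sum fun i _ => by
    rw [mApp_apply]
    exact Finset.sum_mul_sq_le_sq_mul_sq _ _ _

lemma frob_outer (u v : E d) : frob (outer u v) = ‖u‖ * ‖v‖ := by
  refine (sq_eq_sq₀ (frob_nonneg _) (by positivity)).1 ?_
  rw [mul_pow, frob_sq, EuclideanSpace.real_norm_sq_eq, EuclideanSpace.real_norm_sq_eq,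
    Finset.sum_mul_sum]
  simp [outer, mul_pow]

lemma frob_le_of_norm_mApp_le (A : Mat d) {C : ℝ} (hC : 0 ≤ C)
    (h : ∀ v, ‖mApp A v‖ ≤ C * ‖v‖) : frob A ≤ √d * C := by
  refine Real.sqrt_le_iff.2 ⟨by positivity, ?_⟩
  rw [Finset.sum_comm, mul_pow, Real.sq_sqrt (Nat.cast_nonneg d)]
  have hcol : ∀ j, ∑ i, A i j ^ 2 ≤ C ^ 2 := fun j => by
    have h1 := pow_le_pow_left₀ (norm_nonneg _) (h (EuclideanSpace.single j 1)) 2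
    rw [EuclideanSpace.real_norm_sq_eq] at h1
    simpa [mApp_apply, PiLp.single_apply] using h1
  calc ∑ j, ∑ i, A i j ^ 2 ≤ ∑ _j : Fin d, C ^ 2 := Finset.sum_le_sum fun j _ => hcol j
    _ = d * C ^ 2 := by simp

/-- Multiplying on the right by the orthogonal projection onto `yᗮ` removes `‖X y‖² / ‖y‖²` from
the squared Frobenius norm. -/
lemma frob_sq_mul_proj (X : Mat d) {y : E d} (hy : y ≠ 0) :
    frob (X * (1 - (‖y‖ ^ 2)⁻¹ • outer y y)) ^ 2 = frob X ^ 2 - (‖mApp X y‖ / ‖y‖) ^ 2 := by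
  have hy' : ‖y‖ ^ 2 ≠ 0 := by simpa using hy
  have hentry : ∀ i j, (X * (1 - (‖y‖ ^ 2)⁻¹ • outer y y)) i j
      = X i j - (‖y‖ ^ 2)⁻¹ * (mApp X y i * y j) := fun i j => by
    rw [Matrix.mul_sub, Matrix.mul_one, Matrix.mul_smul, mul_outer]
    simp [outer]
  have hrow : ∀ i, ∑ j, (X i j - (‖y‖ ^ 2)⁻¹ * (mApp X y i * y j)) ^ 2
      = ∑ j, X i j ^ 2 - (‖y‖ ^ 2)⁻¹ * mApp X y i ^ 2 := fun i => by
    have h1 : ∑ j, (X i j - (‖y‖ ^ 2)⁻¹ * (mApp X y i * y j)) ^ 2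
        = ∑ j, X i j ^ 2 - 2 * (‖y‖ ^ 2)⁻¹ * mApp X y i * ∑ j, X i j * y j
          + ((‖y‖ ^ 2)⁻¹ * mApp X y i) ^ 2 * ∑ j, y j ^ 2 := by
      rw [Finset.mul_sum, Finset.mul_sum, ← Finset.sum_sub_distrib, ← Finset.sum_add_distrib]
      exact Finset.sum_congr rfl fun j _ => by ring
    rw [h1, ← mApp_apply, ← EuclideanSpace.real_norm_sq_eq]
    field_simp
    ring
  simp only [frob_sq, hentry, hrow]
  rw [Finset.sum_sub_distrib, ← Finset.mul_sum, ← EuclideanSpace.real_norm_sq_eq, div_pow]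
  ring

lemma frob_proj_mul_mul_proj (X : Mat d) {y : E d} (hy : y ≠ 0) :
    frob ((1 - (‖y‖ ^ 2)⁻¹ • outer y y) * X * (1 - (‖y‖ ^ 2)⁻¹ • outer y y)) ^ 2
      ≤ frob X ^ 2 - (‖mApp X y‖ / ‖y‖) ^ 2 := by
  have htr : ((1 - (‖y‖ ^ 2)⁻¹ • outer y y : Mat d))ᵀ = 1 - (‖y‖ ^ 2)⁻¹ • outer y y := by
    simp [outer_transpose]
  rw [Matrix.mul_assoc, ← frob_transpose, Matrix.transpose_mul, htr, frob_sq_mul_proj _ hy,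
    frob_transpose, frob_sq_mul_proj _ hy]
  linarith [sq_nonneg (‖mApp (X * (1 - (‖y‖ ^ 2)⁻¹ • outer y y))ᵀ y‖ / ‖y‖)]

end MatrixLemmas

section UpdateLemmas

variable {d : ℕ}

lemma bfgsUpdate_conj {S : Mat d} (hS : Sᵀ = S) (H : Mat d) (s y : E d) :
    S * bfgsUpdate H s (mApp S y) * S = bfgsUpdate (S * H * S) (mApp S s) y := by
  have hdot : ∀ u v, dot (mApp S u) v = dot u (mApp S v) := fun u v => by
    rw [dot_mApp_left, hS]
  have h1 : ∀ c : ℝ, S * (1 - c • outer s (mApp S y)) = (1 - c • outer (mApp S s) y) * S :=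
    fun c => by
      rw [Matrix.mul_sub, Matrix.sub_mul, Matrix.mul_smul, Matrix.smul_mul, mul_outer, outer_mul,
        hS, Matrix.mul_one, Matrix.one_mul]
  have h2 : ∀ c : ℝ, (1 - c • outer (mApp S y) s) * S = S * (1 - c • outer y (mApp S s)) :=
    fun c => by
      rw [Matrix.mul_sub, Matrix.sub_mul, Matrix.mul_smul, Matrix.smul_mul, mul_outer, outer_mul,
        hS, Matrix.mul_one, Matrix.one_mul]
  have h3 : S * outer s s * S = outer (mApp S s) (mApp S s) := by
    rw [mul_outer, outer_mul, hS]
  have hassoc : ∀ X Y : Mat d, S * (X * H * Y) * S = (S * X) * H * (Y * S) := fun X Y => by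
    simp only [Matrix.mul_assoc]
  have hassoc' : ∀ X Y : Mat d, X * S * H * (S * Y) = X * (S * H * S) * Y := fun X Y => by
    simp only [Matrix.mul_assoc]
  unfold bfgsUpdate
  rw [hdot y s, ← hdot s y, Matrix.mul_add, Matrix.add_mul, Matrix.mul_smul, Matrix.smul_mul, h3,
    hassoc, h1, h2, hassoc']

lemma norm_proj_le {y : E d} (hy : y ≠ 0) (v : E d) :
    ‖mApp (1 - (‖y‖ ^ 2)⁻¹ • outer y y) v‖ ≤ ‖v‖ := by
  have hy' : ‖y‖ ^ 2 ≠ 0 := by simpa using hy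
  have hv : mApp (1 - (‖y‖ ^ 2)⁻¹ • outer y y) v = v - ((‖y‖ ^ 2)⁻¹ * inner ℝ y v) • y := by
    ext i
    simp only [mApp_apply, Matrix.sub_apply, Matrix.smul_apply, outer, Matrix.of_apply, sub_mul,
      Finset.sum_sub_distrib, PiLp.sub_apply, PiLp.smul_apply, smul_eq_mul, ← dot_eq_inner, dot,
      Finset.mul_sum, Finset.sum_mul]
    congr 1
    · simp [Matrix.one_apply]
    · exact Finset.sum_congr rfl fun j _ => by ring
  refine le_of_sq_le_sq ?_ (norm_nonneg v)
  rw [hv, norm_sub_sq_real, norm_smul, inner_smul_right, real_inner_comm y v, mul_pow,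
    Real.norm_eq_abs, sq_abs]
  have : ((‖y‖ ^ 2)⁻¹ * inner ℝ y v) ^ 2 * ‖y‖ ^ 2 = (‖y‖ ^ 2)⁻¹ * inner ℝ y v ^ 2 := by
    field_simp
  rw [this]
  have : 0 ≤ (‖y‖ ^ 2)⁻¹ * (inner ℝ y v) ^ 2 := by positivity
  nlinarith

lemma norm_mApp_le_of_sub_one (A : Mat d) (v : E d) :
    ‖mApp A v‖ ≤ (1 + frob (A - 1)) * ‖v‖ := by
  have h := norm_mApp_le_frob (A - 1) v
  rw [mApp_sub_left, mApp_one] at h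
  linarith [norm_le_norm_add_norm_sub' (mApp A v) v]

/-- Quantitative estimates for nearly equal secant vectors. -/
lemma secant_estimates {s y : E d} {τ : ℝ} (hτ0 : 0 ≤ τ) (hτ1 : τ < 1) (hs : s ≠ 0)
    (hys : ‖y - s‖ ≤ τ * ‖s‖) :
    0 < dot y s ∧ y ≠ 0 ∧ (1 - τ) * ‖s‖ ≤ ‖y‖ ∧
      ‖(‖y‖ ^ 2)⁻¹ • y - (dot y s)⁻¹ • s‖ * ‖y‖ ≤ τ / (1 - τ) := by
  have hs' : 0 < ‖s‖ := norm_pos_iff.2 hs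
  have hτ : 0 < 1 - τ := by linarith
  have hle : (1 - τ) * ‖s‖ ≤ ‖y‖ := by
    linarith [norm_le_norm_add_norm_sub y s]
  have hy' : 0 < ‖y‖ := lt_of_lt_of_le (by positivity) hle
  have hsq : ‖y - s‖ ^ 2 ≤ τ ^ 2 * ‖s‖ ^ 2 := by
    rw [← mul_pow]; exact pow_le_pow_left₀ (norm_nonneg _) hys 2
  rw [norm_sub_sq_real, ← dot_eq_inner] at hsq
  have hτ2 : 0 < 1 - τ ^ 2 := by nlinarith
  have hlow : ‖y‖ ^ 2 + (1 - τ ^ 2) * ‖s‖ ^ 2 ≤ 2 * dot y s := by linarith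
  have hρ : 0 < dot y s := by
    have : 0 < (1 - τ ^ 2) * ‖s‖ ^ 2 := by positivity
    nlinarith [sq_nonneg ‖y‖]
  have hcos : (1 - τ ^ 2) * (‖s‖ ^ 2 * ‖y‖ ^ 2) ≤ dot y s ^ 2 := by
    have h0 : 0 ≤ ‖y‖ ^ 2 + (1 - τ ^ 2) * ‖s‖ ^ 2 := by positivity
    have h1 := pow_le_pow_left₀ h0 hlow 2
    nlinarith [sq_nonneg (‖y‖ ^ 2 - (1 - τ ^ 2) * ‖s‖ ^ 2)]
  refine ⟨hρ, norm_pos_iff.1 hy', hle, ?_⟩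
  set w := (‖y‖ ^ 2)⁻¹ • y - (dot y s)⁻¹ • s with hw
  have hwn : (‖w‖ * ‖y‖) ^ 2 = ‖s‖ ^ 2 * ‖y‖ ^ 2 / dot y s ^ 2 - 1 := by
    rw [mul_pow, hw, norm_sub_sq_real, norm_smul, norm_smul, inner_smul_left, inner_smul_right,
      ← dot_eq_inner]
    simp only [Real.norm_eq_abs, conj_trivial]
    rw [mul_pow, mul_pow, sq_abs, sq_abs]
    field_simp
    ring
  rw [le_div_iff₀ hτ]
  refine le_of_sq_le_sq ?_ hτ0
  have h2 : (1 - τ ^ 2) * (‖w‖ * ‖y‖) ^ 2 ≤ τ ^ 2 := by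
    have : (1 - τ ^ 2) * (‖s‖ ^ 2 * ‖y‖ ^ 2 / dot y s ^ 2) ≤ 1 := by
      rw [← mul_div_assoc, div_le_one (by positivity)]; exact hcos
    rw [hwn]; linarith
  calc (‖w‖ * ‖y‖ * (1 - τ)) ^ 2 = (1 - τ) ^ 2 * (‖w‖ * ‖y‖) ^ 2 := by ring
    _ ≤ (1 - τ ^ 2) * (‖w‖ * ‖y‖) ^ 2 := by
        apply mul_le_mul_of_nonneg_right _ (sq_nonneg _)
        nlinarith
    _ ≤ τ ^ 2 := h2

lemma bfgsUpdate_sub_one_eq (A : Mat d) {s y : E d} (hy : y ≠ 0) :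
    bfgsUpdate A s y - 1 =
      (1 - (‖y‖ ^ 2)⁻¹ • outer y y) * (A - 1) * (1 - (‖y‖ ^ 2)⁻¹ • outer y y)
      + (outer ((‖y‖ ^ 2)⁻¹ • y - (dot y s)⁻¹ • s)
            (mApp (1 - (‖y‖ ^ 2)⁻¹ • outer y y) (mApp Aᵀ y))
        + (outer (mApp (1 - (‖y‖ ^ 2)⁻¹ • outer y y) (mApp A y))
            ((‖y‖ ^ 2)⁻¹ • y - (dot y s)⁻¹ • s)
        + (outer (dot y (mApp A y) • ((‖y‖ ^ 2)⁻¹ • y - (dot y s)⁻¹ • s))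
            ((‖y‖ ^ 2)⁻¹ • y - (dot y s)⁻¹ • s)
        + (outer (-((‖y‖ ^ 2)⁻¹ • y - (dot y s)⁻¹ • s)) s
        + outer ((‖y‖ ^ 2)⁻¹ • y) (s - y))))) := by
  have hy' : ‖y‖ ^ 2 ≠ 0 := by simpa using hy
  set a := (‖y‖ ^ 2)⁻¹ with ha
  set w := a • y - (dot y s)⁻¹ • s with hw
  set Q : Mat d := 1 - a • outer y y with hQ
  have hQt : Qᵀ = Q := by simp [hQ, outer_transpose]
  have hQQ : Q * Q = Q := by
    have : a * a * ‖y‖ ^ 2 = a := by rw [ha]; field_simp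
    simp only [hQ, Matrix.mul_sub, Matrix.sub_mul, Matrix.mul_one, Matrix.one_mul,
      Matrix.smul_mul, Matrix.mul_smul, outer_mul_outer, dot_self, smul_sub, smul_smul]
    rw [← mul_assoc, this]; abel
  have hP : (1 - (dot y s)⁻¹ • outer s y : Mat d) = Q + outer w y := by
    ext i j; simp [hQ, hw, outer]; ring
  have hP' : (1 - (dot s y)⁻¹ • outer y s : Mat d) = Q + outer y w := by
    rw [dot_comm s y]; ext i j; simp [hQ, hw, outer]; ring
  have h1 : outer w (mApp Q (mApp Aᵀ y)) = outer w y * A * Q := by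
    rw [outer_mul, outer_mul, hQt]
  have h2 : outer (mApp Q (mApp A y)) w = Q * A * outer y w := by
    rw [mul_outer, mApp_mul]
  have h3 : outer (dot y (mApp A y) • w) w = outer w y * A * outer y w := by
    rw [Matrix.mul_assoc, mul_outer, outer_mul_outer]; ext i j; simp [outer, mul_assoc]
  have h4 : outer (-w) s + outer (a • y) (s - y) = (dot y s)⁻¹ • outer s s - a • outer y y := by
    ext i j; simp [hw, outer]; ring
  have h5 : Q * (A - 1) * Q = Q * A * Q - Q := by
    rw [Matrix.mul_sub Q, Matrix.sub_mul (Q * A), Matrix.mul_one, hQQ]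
  have h6 : a • outer y y = 1 - Q := by simp [hQ]
  unfold bfgsUpdate
  rw [hP, hP', h1, h2, h3, h4, h5, h6]
  noncomm_ring

/-- One BFGS step in the metric where the exact inverse Hessian is the identity. -/
lemma frob_bfgsUpdate_sub_one_le (A : Mat d) {s y : E d} {τ : ℝ} (hτ0 : 0 ≤ τ) (hτ1 : τ < 1)
    (hs : s ≠ 0) (hys : ‖y - s‖ ≤ τ * ‖s‖) :
    frob (bfgsUpdate A s y - 1) ≤
      frob ((1 - (‖y‖ ^ 2)⁻¹ • outer y y) * (A - 1) * (1 - (‖y‖ ^ 2)⁻¹ • outer y y))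
        + (2 * frob (A - 1) + 4) / (1 - τ) ^ 2 * τ := by
  obtain ⟨-, hy, hle, hω⟩ := secant_estimates hτ0 hτ1 hs hys
  have hτ : 0 < 1 - τ := by linarith
  have hy' : 0 < ‖y‖ := norm_pos_iff.2 hy
  rw [bfgsUpdate_sub_one_eq A hy]
  set w := (‖y‖ ^ 2)⁻¹ • y - (dot y s)⁻¹ • s with hw
  set Q : Mat d := 1 - (‖y‖ ^ 2)⁻¹ • outer y y with hQ
  set n := frob (A - 1) with hn
  have hn0 : 0 ≤ n := frob_nonneg _
  set t := τ / (1 - τ) with ht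
  have ht0 : 0 ≤ t := by positivity
  have hA : ‖mApp A y‖ ≤ (1 + n) * ‖y‖ := norm_mApp_le_of_sub_one A y
  have hAt : ‖mApp Aᵀ y‖ ≤ (1 + n) * ‖y‖ := by
    have h := norm_mApp_le_of_sub_one Aᵀ y
    have h' : Aᵀ - 1 = (A - 1)ᵀ := by simp
    rwa [h', frob_transpose] at h
  have e1 : frob (outer w (mApp Q (mApp Aᵀ y))) ≤ (1 + n) * t := by
    rw [frob_outer]
    calc ‖w‖ * ‖mApp Q (mApp Aᵀ y)‖ ≤ ‖w‖ * ((1 + n) * ‖y‖) := by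
          gcongr; exact (norm_proj_le hy _).trans hAt
      _ = (1 + n) * (‖w‖ * ‖y‖) := by ring
      _ ≤ _ := by gcongr
  have e2 : frob (outer (mApp Q (mApp A y)) w) ≤ (1 + n) * t := by
    rw [frob_outer]
    calc ‖mApp Q (mApp A y)‖ * ‖w‖ ≤ ((1 + n) * ‖y‖) * ‖w‖ := by
          gcongr; exact (norm_proj_le hy _).trans hA
      _ = (1 + n) * (‖w‖ * ‖y‖) := by ring
      _ ≤ _ := by gcongr
  have e3 : frob (outer (dot y (mApp A y) • w) w) ≤ (1 + n) * t ^ 2 := by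
    rw [frob_outer, norm_smul, dot_eq_inner]
    calc ‖inner ℝ y (mApp A y)‖ * ‖w‖ * ‖w‖ ≤ (‖y‖ * ((1 + n) * ‖y‖)) * ‖w‖ * ‖w‖ := by
          gcongr
          exact (norm_inner_le_norm _ _).trans (by gcongr)
      _ = (1 + n) * (‖w‖ * ‖y‖) ^ 2 := by ring
      _ ≤ _ := by gcongr
  have e4 : frob (outer (-w) s) ≤ t / (1 - τ) := by
    rw [frob_outer, norm_neg, le_div_iff₀ hτ]
    calc ‖w‖ * ‖s‖ * (1 - τ) = ‖w‖ * ((1 - τ) * ‖s‖) := by ring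
      _ ≤ ‖w‖ * ‖y‖ := by gcongr
      _ ≤ t := hω
  have e5 : frob (outer ((‖y‖ ^ 2)⁻¹ • y) (s - y)) ≤ t := by
    rw [frob_outer, norm_smul, norm_sub_rev s y, norm_inv, norm_pow, norm_norm, ht,
      le_div_iff₀ hτ]
    calc (‖y‖ ^ 2)⁻¹ * ‖y‖ * ‖y - s‖ * (1 - τ) = ‖y - s‖ * (1 - τ) / ‖y‖ := by
          field_simp
      _ ≤ τ * ‖s‖ * (1 - τ) / ‖y‖ := by gcongr
      _ ≤ τ := by
          rw [div_le_iff₀ hy']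
          nlinarith [mul_le_mul_of_nonneg_left hle hτ0]
  have hsum := frob_add_le (Q * (A - 1) * Q) (outer w (mApp Q (mApp Aᵀ y))
        + (outer (mApp Q (mApp A y)) w + (outer (dot y (mApp A y) • w) w
        + (outer (-w) s + outer ((‖y‖ ^ 2)⁻¹ • y) (s - y)))))
  have hsum1 := frob_add_le (outer w (mApp Q (mApp Aᵀ y)))
        (outer (mApp Q (mApp A y)) w + (outer (dot y (mApp A y) • w) w
        + (outer (-w) s + outer ((‖y‖ ^ 2)⁻¹ • y) (s - y))))
  have hsum2 := frob_add_le (outer (mApp Q (mApp A y)) w) (outer (dot y (mApp A y) • w) w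
        + (outer (-w) s + outer ((‖y‖ ^ 2)⁻¹ • y) (s - y)))
  have hsum3 := frob_add_le (outer (dot y (mApp A y) • w) w)
        (outer (-w) s + outer ((‖y‖ ^ 2)⁻¹ • y) (s - y))
  have hsum4 := frob_add_le (outer (-w) s) (outer ((‖y‖ ^ 2)⁻¹ • y) (s - y))
  have hfin : (1 + n) * (2 * t + t ^ 2) + (t / (1 - τ) + t)
      ≤ (2 * n + 4) / (1 - τ) ^ 2 * τ := by
    have : (1 + n) * (2 * t + t ^ 2) + (t / (1 - τ) + t)
        = (2 * n + 4) / (1 - τ) ^ 2 * τ - (n + 2) * τ ^ 2 / (1 - τ) ^ 2 := by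
      rw [ht]; field_simp; ring
    rw [this]
    have : 0 ≤ (n + 2) * τ ^ 2 / (1 - τ) ^ 2 := by positivity
    linarith
  linarith

end UpdateLemmas

lemma prod_range_le_sum_div_pow (a : ℕ → ℝ) (ha : ∀ k, 0 ≤ a k) {k : ℕ} (hk : 1 ≤ k) :
    ∏ j ∈ range k, a j ≤ ((∑ j ∈ range k, a j) / k) ^ k := by
  have hk0 : (k : ℝ) ≠ 0 := by positivity
  have h := Real.geom_mean_le_arith_mean_weighted (range k) (fun _ => (k : ℝ)⁻¹) a
    (fun _ _ => by positivity) (by simp [hk0]) (fun j _ => ha j)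
  rw [← Finset.mul_sum] at h
  have h' := pow_le_pow_left₀ (Finset.prod_nonneg fun j _ => Real.rpow_nonneg (ha j) _) h k
  rw [← Finset.prod_pow] at h'
  calc ∏ j ∈ range k, a j = ∏ j ∈ range k, (a j ^ (k : ℝ)⁻¹) ^ k :=
        Finset.prod_congr rfl fun j _ => (Real.rpow_inv_natCast_pow (ha j) (by omega)).symm
    _ ≤ _ := h'
    _ = _ := by rw [div_eq_inv_mul]

/-- A scalar recursion with linear rate and summable perturbations forces superlinear decay. -/
lemma superlinear_of_recursion {ρ n θ q : ℕ → ℝ} {m K C₁ C₂ ε δ r : ℝ}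
    (hρ : ∀ k, 0 ≤ ρ k) (hn : ∀ k, 0 ≤ n k) (hθ : ∀ k, 0 ≤ θ k) (hm : 0 ≤ m)
    (hK : 0 ≤ K) (hC₁ : 0 ≤ C₁) (hC₂ : 0 ≤ C₂) (hε : 0 ≤ ε) (hδ : 0 ≤ δ) (hr0 : 0 ≤ r)
    (hr1 : r < 1) (hKδ : K * (ε / (1 - r)) ≤ δ) (hn0 : n 0 ≤ δ) (hρ0 : m * ρ 0 ≤ ε)
    (hstep : ∀ k, n k ≤ 2 * δ → m * ρ k ≤ ε →
      ρ (k + 1) ≤ r * ρ k ∧ ρ (k + 1) ≤ (C₁ * θ k + C₂ * (m * ρ k)) * ρ k ∧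
      θ k ^ 2 ≤ n k ^ 2 - q k ^ 2 ∧ n (k + 1) ≤ q k + K * (m * ρ k))
    {k : ℕ} (hk : 1 ≤ k) :
    ρ k ≤ ((C₁ * (2 * √2 * δ * √k) + C₂ * (ε / (1 - r))) / k) ^ k * ρ 0 := by
  have hr : 0 < 1 - r := by linarith
  have hpot : ∀ j, 0 ≤ K * (ε / (1 - r)) * r ^ j := fun j => by positivity
  have inv : ∀ k, m * ρ k ≤ ε * r ^ k ∧ n k + K * (ε / (1 - r)) * r ^ k ≤ 2 * δ ∧
      ∑ j ∈ range k, θ j ^ 2 ≤ 4 * δ * (2 * δ - (n k + K * (ε / (1 - r)) * r ^ k)) ∧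
      ∑ j ∈ range k, m * ρ j ≤ ε * (1 - r ^ k) / (1 - r) ∧
      ρ k ≤ (∏ j ∈ range k, (C₁ * θ j + C₂ * (m * ρ j))) * ρ 0 := by
    intro k
    induction k with
    | zero =>
      refine ⟨by simpa using hρ0, by simp; linarith, ?_, by simp, by simp⟩
      simp only [range_zero, sum_empty, pow_zero, mul_one]
      exact mul_nonneg (by positivity) (by linarith)
    | succ k ih =>
      obtain ⟨h1, h2, h3, h4, h5⟩ := ih
      have hrk : r ^ k ≤ 1 := pow_le_one₀ hr0 hr1.le
      have hn2 : n k ≤ 2 * δ := by linarith [hpot k]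
      have hσ : m * ρ k ≤ ε := h1.trans (mul_le_of_le_one_right hε hrk)
      obtain ⟨s1, s2, s3, s4⟩ := hstep k hn2 hσ
      have hq : q k ≤ n k := le_of_sq_le_sq (by nlinarith [sq_nonneg (θ k)]) (hn k)
      have hpow : K * (ε / (1 - r)) * r ^ (k + 1)
          = K * (ε / (1 - r)) * r ^ k - K * (ε * r ^ k) := by
        rw [pow_succ]; field_simp; ring
      have hKs : K * (m * ρ k) ≤ K * (ε * r ^ k) := by gcongr
      have hdec : n (k + 1) + K * (ε / (1 - r)) * r ^ (k + 1)
          ≤ n k + K * (ε / (1 - r)) * r ^ k - (n k - q k) := by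
        rw [hpow]; linarith
      refine ⟨?_, by linarith, ?_, ?_, ?_⟩
      · calc m * ρ (k + 1) ≤ m * (r * ρ k) := by gcongr
          _ = m * ρ k * r := by ring
          _ ≤ ε * r ^ k * r := by gcongr
          _ = _ := by ring
      · have hθq : θ k ^ 2 ≤ 4 * δ * (n k - q k) := by
          refine s3.trans ?_
          have : (n k - q k) * (n k + q k) ≤ (n k - q k) * (4 * δ) :=
            mul_le_mul_of_nonneg_left (by linarith) (by linarith)
          linarith
        rw [sum_range_succ]
        have := mul_le_mul_of_nonneg_left hdec (by positivity : 0 ≤ 4 * δ)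
        linarith
      · rw [sum_range_succ]
        have : ε * (1 - r ^ (k + 1)) / (1 - r) = ε * (1 - r ^ k) / (1 - r) + ε * r ^ k := by
          rw [pow_succ]; field_simp; ring
        linarith
      · have hc : 0 ≤ C₁ * θ k + C₂ * (m * ρ k) :=
          add_nonneg (mul_nonneg hC₁ (hθ k)) (mul_nonneg hC₂ (mul_nonneg hm (hρ k)))
        rw [prod_range_succ]
        calc ρ (k + 1) ≤ _ := s2
          _ ≤ (C₁ * θ k + C₂ * (m * ρ k))
              * ((∏ j ∈ range k, (C₁ * θ j + C₂ * (m * ρ j))) * ρ 0) := by gcongr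
          _ = _ := by ring
  obtain ⟨-, -, h3, h4, h5⟩ := inv k
  have ha : ∀ j, 0 ≤ C₁ * θ j + C₂ * (m * ρ j) := fun j =>
    add_nonneg (mul_nonneg hC₁ (hθ j)) (mul_nonneg hC₂ (mul_nonneg hm (hρ j)))
  have hθsum : ∑ j ∈ range k, θ j ≤ 2 * √2 * δ * √k := by
    refine le_of_sq_le_sq ?_ (by positivity)
    have hsq : ∑ j ∈ range k, θ j ^ 2 ≤ 8 * δ ^ 2 := by
      have : 0 ≤ 4 * δ * (n k + K * (ε / (1 - r)) * r ^ k) :=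
        mul_nonneg (by positivity) (add_nonneg (hn k) (hpot k))
      linarith
    calc (∑ j ∈ range k, θ j) ^ 2 ≤ k * ∑ j ∈ range k, θ j ^ 2 := by
          simpa using sq_sum_le_card_mul_sum_sq (s := range k) (f := θ)
      _ ≤ k * (8 * δ ^ 2) := by gcongr
      _ = (2 * √2 * δ * √k) ^ 2 := by
          rw [mul_pow, mul_pow, mul_pow, Real.sq_sqrt (by norm_num),
            Real.sq_sqrt (Nat.cast_nonneg k)]
          ring
  have hρsum : ∑ j ∈ range k, m * ρ j ≤ ε / (1 - r) := by
    refine h4.trans ?_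
    gcongr
    exact mul_le_of_le_one_right hε (by linarith [pow_nonneg hr0 k])
  have hsum0 : 0 ≤ ∑ j ∈ range k, (C₁ * θ j + C₂ * (m * ρ j)) := Finset.sum_nonneg fun j _ => ha j
  calc ρ k ≤ _ := h5
    _ ≤ ((∑ j ∈ range k, (C₁ * θ j + C₂ * (m * ρ j))) / k) ^ k * ρ 0 := by
        gcongr
        · exact hρ 0
        · exact prod_range_le_sum_div_pow _ ha hk
    _ ≤ _ := by
        gcongr
        · exact hρ 0
        · rw [sum_add_distrib, ← Finset.mul_sum, ← Finset.mul_sum]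
          gcongr

/-- One BFGS iteration in the metric of the Hessian at the minimizer: `e`, `e'` are the transformed
errors and `γ`, `γ'` the transformed gradients at two consecutive iterates. -/
lemma bfgs_step {d : ℕ} (A : Mat d) {e e' γ γ' : E d} {m ε δ r : ℝ} (hm : 0 ≤ m) (hε : 0 < ε)
    (hδ : 0 < δ) (hr1 : r < 1) (hc2 : (2 * δ + 1) * ε + 2 * δ ≤ r)
    (he' : e' = e - mApp A γ) (hs : e' - e ≠ 0)
    (hγ : ‖γ - e‖ ≤ m * ‖e‖ * ‖e‖) (hγ' : ‖γ' - e'‖ ≤ m * ‖e'‖ * ‖e'‖)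
    (hys : ‖e'‖ ≤ ‖e‖ → ‖(γ' - γ) - (e' - e)‖ ≤ m * ‖e‖ * ‖e' - e‖)
    (hn : frob (A - 1) ≤ 2 * δ) (hσ : m * ‖e‖ ≤ ε) :
    ‖e'‖ ≤ r * ‖e‖ ∧
    ‖e'‖ ≤ ((1 + ε) * (1 + r) / ((1 - ε) * (1 - r)) * (‖mApp (A - 1) (γ' - γ)‖ / ‖γ' - γ‖)
        + (1 + r) / ((1 - ε) * (1 - r)) * (m * ‖e‖)) * ‖e‖ ∧
    (‖mApp (A - 1) (γ' - γ)‖ / ‖γ' - γ‖) ^ 2 ≤ frob (A - 1) ^ 2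
      - frob ((1 - (‖γ' - γ‖ ^ 2)⁻¹ • outer (γ' - γ) (γ' - γ)) * (A - 1)
          * (1 - (‖γ' - γ‖ ^ 2)⁻¹ • outer (γ' - γ) (γ' - γ))) ^ 2 ∧
    frob (bfgsUpdate A (e' - e) (γ' - γ) - 1)
      ≤ frob ((1 - (‖γ' - γ‖ ^ 2)⁻¹ • outer (γ' - γ) (γ' - γ)) * (A - 1)
          * (1 - (‖γ' - γ‖ ^ 2)⁻¹ • outer (γ' - γ) (γ' - γ)))
        + ((2 * δ + 1) * (4 * (1 + 2 * ε ^ 2 + ε ^ 3) / (1 - ε) ^ 2) + (3 + 2 * ε) / (1 - ε))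
          * (m * ‖e‖) := by
  have hεr : ε + 2 * δ < 1 := by nlinarith [mul_pos hδ hε]
  have hδr : 2 * δ ≤ r := by nlinarith [mul_pos hδ hε]
  have hE : ∀ v, ‖mApp (A - 1) v‖ ≤ 2 * δ * ‖v‖ := fun v =>
    (norm_mApp_le_frob _ v).trans (by gcongr)
  have hAv : ∀ v, mApp A v = v + mApp (A - 1) v := fun v => by
    rw [mApp_sub_left, mApp_one]; abel
  have hσ0 : 0 ≤ m * ‖e‖ := by positivity
  have hlin : ‖e'‖ ≤ r * ‖e‖ := by
    have h1 : e' = -((γ - e) + mApp (A - 1) γ) := by rw [he', hAv]; abel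
    have h2 : ‖γ - e‖ ≤ ε * ‖e‖ := hγ.trans (by gcongr)
    have h3 : ‖γ‖ ≤ (1 + ε) * ‖e‖ := by linarith [norm_le_norm_add_norm_sub' γ e]
    calc ‖e'‖ ≤ ‖γ - e‖ + ‖mApp (A - 1) γ‖ := by
          rw [h1, norm_neg]; exact norm_add_le _ _
      _ ≤ ε * ‖e‖ + 2 * δ * ((1 + ε) * ‖e‖) := by
          gcongr; exact (hE γ).trans (by gcongr)
      _ = ((2 * δ + 1) * ε + 2 * δ) * ‖e‖ := by ring
      _ ≤ r * ‖e‖ := by gcongr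
  have hmono : ‖e'‖ ≤ ‖e‖ := hlin.trans (mul_le_of_le_one_left (norm_nonneg _) hr1.le)
  have hsec := hys hmono
  have hσ1 : m * ‖e‖ < 1 := by linarith
  obtain ⟨-, hy0, -, -⟩ := secant_estimates hσ0 hσ1 hs hsec
  have hγe : γ' = (γ' - γ) + γ := by abel
  have hsn : ‖e' - e‖ ≤ (1 + r) * ‖e‖ := by linarith [norm_sub_le e' e]
  refine ⟨hlin, ?_, ?_, ?_⟩
  · set y := γ' - γ with hy
    have hyn : 0 < ‖y‖ := norm_pos_iff.2 hy0
    set θ := ‖mApp (A - 1) y‖ / ‖y‖ with hθ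
    have hθ0 : 0 ≤ θ := by positivity
    have hid : mApp A γ' = mApp (A - 1) y + (y - (e' - e)) := by
      rw [hγe, mApp_add, hAv y, he']; abel
    have hlow : (1 - r) * ‖γ'‖ ≤ ‖mApp A γ'‖ := by
      have h1 := norm_sub_le (mApp A γ') (mApp (A - 1) γ')
      have h2 : mApp A γ' - mApp (A - 1) γ' = γ' := by rw [hAv]; abel
      rw [h2] at h1
      have h3 : 2 * δ * ‖γ'‖ ≤ r * ‖γ'‖ := by gcongr
      linarith [hE γ']
    have hγlow : (1 - ε) * ‖e'‖ ≤ ‖γ'‖ := by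
      have h1 : ‖γ' - e'‖ ≤ ε * ‖e'‖ := by
        refine hγ'.trans ?_
        have : m * ‖e'‖ ≤ ε := (mul_le_mul_of_nonneg_left hmono hm).trans hσ
        gcongr
      linarith [norm_le_norm_add_norm_sub γ' e']
    have hyup : ‖y‖ ≤ (1 + ε) * ‖e' - e‖ := by
      have h1 : m * ‖e‖ * ‖e' - e‖ ≤ ε * ‖e' - e‖ := by gcongr
      linarith [norm_le_norm_add_norm_sub' y (e' - e)]
    have hup : ‖mApp A γ'‖ ≤ (θ * (1 + ε) + m * ‖e‖) * ((1 + r) * ‖e‖) := by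
      rw [hid]
      calc _ ≤ ‖mApp (A - 1) y‖ + ‖y - (e' - e)‖ := norm_add_le _ _
        _ = θ * ‖y‖ + ‖y - (e' - e)‖ := by rw [hθ, div_mul_cancel₀ _ hyn.ne']
        _ ≤ θ * ((1 + ε) * ‖e' - e‖) + m * ‖e‖ * ‖e' - e‖ := by gcongr
        _ = (θ * (1 + ε) + m * ‖e‖) * ‖e' - e‖ := by ring
        _ ≤ _ := by gcongr
    have hr' : 0 < 1 - r := by linarith
    have hε' : 0 < 1 - ε := by linarith
    have hall : (1 - ε) * (1 - r) * ‖e'‖ ≤ (θ * (1 + ε) + m * ‖e‖) * ((1 + r) * ‖e‖) := by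
      calc (1 - ε) * (1 - r) * ‖e'‖ = (1 - r) * ((1 - ε) * ‖e'‖) := by ring
        _ ≤ (1 - r) * ‖γ'‖ := by gcongr
        _ ≤ _ := hlow.trans hup
    have hrw : ((1 + ε) * (1 + r) / ((1 - ε) * (1 - r)) * θ
        + (1 + r) / ((1 - ε) * (1 - r)) * (m * ‖e‖)) * ‖e‖
        = (θ * (1 + ε) + m * ‖e‖) * ((1 + r) * ‖e‖) / ((1 - ε) * (1 - r)) := by
      field_simp
    rw [hrw, le_div_iff₀ (by positivity)]
    linarith
  · linarith [frob_proj_mul_mul_proj (A - 1) hy0]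
  · refine (frob_bfgsUpdate_sub_one_le A hσ0 hσ1 hs hsec).trans ?_
    have hε' : 0 < 1 - ε := by linarith
    gcongr
    calc (2 * frob (A - 1) + 4) / (1 - m * ‖e‖) ^ 2
        ≤ ((2 * δ + 1) * (4 * (1 + 2 * ε ^ 2 + ε ^ 3))) / (1 - ε) ^ 2 := by
          gcongr
          have : 0 ≤ (2 * δ + 1) * (4 * (2 * ε ^ 2 + ε ^ 3)) := by positivity
          linarith
      _ = (2 * δ + 1) * (4 * (1 + 2 * ε ^ 2 + ε ^ 3) / (1 - ε) ^ 2) := by ring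
      _ ≤ _ := le_add_of_nonneg_right (by positivity)

/-- Mean value estimate for the gradient in the metric `H_*`. -/
lemma gradient_deviation {d : ℕ} {g : E d → E d} {Hess : E d → Mat d} {xs : E d} {μ M : ℝ}
    (hμ : 0 < μ) (hM : 0 < M)
    (hHd : ∀ x, HasFDerivAt g (Matrix.toEuclideanCLM (𝕜 := ℝ) (Hess x)) x)
    (hLip : ∀ x, spec (Hess x - Hess xs) ≤ M * ‖x - xs‖)
    {S T : Mat d} (hS2 : S * S = Hess xs) (hTS : T * S = 1)
    (hSlow : ∀ v, √μ * ‖v‖ ≤ ‖mApp S v‖) (hT : ∀ v, √μ * ‖mApp T v‖ ≤ ‖v‖)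
    {a b : E d} {R : ℝ} (ha : ‖mApp S (a - xs)‖ ≤ R) (hb : ‖mApp S (b - xs)‖ ≤ R) :
    ‖mApp T (g a - g b) - mApp S (a - b)‖ ≤ M / (μ * √μ) * R * ‖mApp S (a - b)‖ := by
  have hμ' : 0 < √μ := Real.sqrt_pos.2 hμ
  have hmem : ∀ z, ‖mApp S (z - xs)‖ ≤ R → z ∈ Metric.closedBall xs (R / √μ) := fun z hz => by
    rw [mem_closedBall_iff_norm, le_div_iff₀ hμ', mul_comm]
    exact (hSlow _).trans hz
  have hR : 0 ≤ R := (norm_nonneg _).trans ha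
  have hmv := (convex_closedBall xs (R / √μ)).norm_image_sub_le_of_norm_hasFDerivWithin_le'
    (φ := Matrix.toEuclideanCLM (𝕜 := ℝ) (Hess xs)) (C := M * (R / √μ))
    (fun z _ => (hHd z).hasFDerivWithinAt)
    (fun z hz => by
      rw [← map_sub]
      refine (hLip z).trans ?_
      gcongr
      exact mem_closedBall_iff_norm.1 hz)
    (hmem b hb) (hmem a ha)
  have hid : mApp T (g a - g b) - mApp S (a - b)
      = mApp T (g a - g b - mApp (Hess xs) (a - b)) := by
    rw [mApp_sub T (g a - g b), ← mApp_mul, ← hS2, ← Matrix.mul_assoc, hTS, Matrix.one_mul]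
  rw [hid]
  have h1 : √μ * ‖mApp T (g a - g b - mApp (Hess xs) (a - b))‖ ≤ M * (R / √μ) * ‖a - b‖ :=
    (hT _).trans hmv
  have h2 := mul_le_mul_of_nonneg_left (hSlow (a - b)) (by positivity : 0 ≤ M * R)
  have hsq : √μ * √μ = μ := Real.mul_self_sqrt hμ.le
  have h3 : M * (R / √μ) * ‖a - b‖ ≤ M * R * ‖mApp S (a - b)‖ / μ := by
    rw [le_div_iff₀ hμ]
    calc M * (R / √μ) * ‖a - b‖ * μ = M * (R / √μ) * ‖a - b‖ * (√μ * √μ) := by rw [hsq]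
      _ = M * R * (√μ * ‖a - b‖) := by field_simp
      _ ≤ _ := h2
  calc ‖mApp T (g a - g b - mApp (Hess xs) (a - b))‖
      ≤ M * R * ‖mApp S (a - b)‖ / μ / √μ := by
        rw [le_div_iff₀ hμ', mul_comm]; exact h1.trans h3
    _ = _ := by field_simp

theorem bfgs_superlinear_convergence_hessian_init
    {d : ℕ}
    (f : E d → ℝ) (g : E d → E d) (Hess : E d → Mat d) (xs : E d)
    (μ L M : ℝ) (hμ : 0 < μ) (hμL : μ ≤ L) (hM : 0 < M)
    -- `g` is the gradient of `f`, and `Hess` its Hessian (so `f` is twice differentiable)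
    (hg : ∀ x, HasGradientAt f (g x) x)
    (hHd : ∀ x, HasFDerivAt g (Matrix.toEuclideanCLM (𝕜 := ℝ) (Hess x)) x)
    -- `xs` is the unique minimizer of `f`
    (hmin : ∀ x, f xs ≤ f x)
    (huniq : ∀ x, (∀ y, f x ≤ f y) → x = xs)
    -- Assumption 1: strong convexity and gradient Lipschitz continuity
    (hgl : ∀ x y, μ * ‖x - y‖ ≤ ‖g x - g y‖)
    (hgu : ∀ x y, ‖g x - g y‖ ≤ L * ‖x - y‖)
    (hHl : ∀ x v, μ * ‖v‖ ^ 2 ≤ dot v (mApp (Hess x) v))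
    (hHu : ∀ x v, dot v (mApp (Hess x) v) ≤ L * ‖v‖ ^ 2)
    -- Assumption 2: Hessian Lipschitz continuity toward the optimum
    (hLip : ∀ x, spec (Hess x - Hess xs) ≤ M * ‖x - xs‖)
    -- `sqH` is the positive definite square root `H_*^{1/2}` of `H_* = ∇²f(x_*)`
    (sqH : Mat d) (hsqH : sqH.PosDef) (hsqH2 : sqH * sqH = Hess xs)
    -- the BFGS method
    (x : ℕ → E d) (H : ℕ → Mat d)
    (hH0pd : (H 0).PosDef)
    (hxup : ∀ k, x (k+1) = x k - mApp (H k) (g (x k)))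
    (hsne : ∀ k, x (k+1) - x k ≠ 0)
    (hHup : ∀ k, H (k+1) = bfgsUpdate (H k) (x (k+1) - x k) (g (x (k+1)) - g (x k)))
    (ε δ r : ℝ) (hε : 0 < ε) (hδ : 0 < δ) (hr0 : 0 < r) (hr1 : r < 1)
    (hc1 : ((2*δ + 1) * (4 * (1 + 2*ε^2 + ε^3) / (1 - ε)^2) + (3 + 2*ε) / (1 - ε)) * (ε / (1 - r)) ≤ δ)
    (hc2 : (2*δ + 1) * ε + 2*δ ≤ r)
    (hx0 : ‖x 0 - xs‖ ≤ μ ^ ((3:ℝ)/2) / (M * Real.sqrt L) * min ε (δ / Real.sqrt (d:ℝ)))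
    (hH0 : H 0 = (Hess (x 0))⁻¹) :
    ∀ k : ℕ, 1 ≤ k →
      ‖x k - xs‖ ≤ Real.sqrt (L / μ) *
        ((2 * Real.sqrt 2 * δ * ((1 + ε) * (1 + r) / ((1 - ε) * (1 - r))) * Real.sqrt (k:ℝ)
            + (1 + ε) * ε * (1 + r) / ((1 - ε)^2 * (1 - r)^2)) / (k:ℝ)) ^ k * ‖x 0 - xs‖ := by
  have hμ' : 0 < √μ := Real.sqrt_pos.2 hμ
  have hL : 0 < L := hμ.trans_le hμL
  have hL' : 0 < √L := Real.sqrt_pos.2 hL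
  have hμ32 : μ ^ ((3:ℝ)/2) = μ * √μ := by
    rw [show (3:ℝ)/2 = 1 + 1/2 by norm_num, Real.rpow_add hμ, Real.rpow_one, ← Real.sqrt_eq_rpow]
  have hgxs : g xs = 0 := by
    have h := IsLocalMin.hasFDerivAt_eq_zero (Filter.Eventually.of_forall hmin)
      (hg xs).hasFDerivAt
    simpa using h
  have hSt : sqHᵀ = sqH := by simpa using hsqH.isHermitian.eq
  have hSdet : IsUnit sqH.det := (Matrix.isUnit_iff_isUnit_det _).1 hsqH.isUnit
  set T := sqH⁻¹ with hTdef
  have hTS : T * sqH = 1 := Matrix.nonsing_inv_mul _ hSdet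
  have hST : sqH * T = 1 := Matrix.mul_nonsing_inv _ hSdet
  have hSsq : ∀ v, ‖mApp sqH v‖ ^ 2 = dot v (mApp (Hess xs) v) := fun v => by
    rw [← dot_self, dot_mApp_left, hSt, ← mApp_mul, hsqH2]
  have hSlow : ∀ v, √μ * ‖v‖ ≤ ‖mApp sqH v‖ := fun v => by
    refine le_of_sq_le_sq ?_ (norm_nonneg _)
    rw [mul_pow, Real.sq_sqrt hμ.le, hSsq]
    exact hHl xs v
  have hSup : ∀ v, ‖mApp sqH v‖ ≤ √L * ‖v‖ := fun v => by
    refine le_of_sq_le_sq ?_ (by positivity)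
    rw [mul_pow, Real.sq_sqrt hL.le, hSsq]
    exact hHu xs v
  have hT : ∀ v, √μ * ‖mApp T v‖ ≤ ‖v‖ := fun v => by
    simpa [← mApp_mul, hST, mApp_one] using hSlow (mApp T v)
  set m := M / (μ * √μ) with hm
  have hm0 : 0 < m := by positivity
  have hdev : ∀ {a b : E d} {R : ℝ}, ‖mApp sqH (a - xs)‖ ≤ R → ‖mApp sqH (b - xs)‖ ≤ R →
      ‖mApp T (g a - g b) - mApp sqH (a - b)‖ ≤ m * R * ‖mApp sqH (a - b)‖ :=
    fun ha hb => gradient_deviation hμ hM hHd hLip hsqH2 hTS hSlow hT ha hb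
  set e : ℕ → E d := fun k => mApp sqH (x k - xs) with he
  set γ : ℕ → E d := fun k => mApp T (g (x k)) with hγ
  set A : ℕ → Mat d := fun k => sqH * H k * sqH with hA
  have hes : ∀ k, e (k + 1) - e k = mApp sqH (x (k + 1) - x k) := fun k => by
    simp only [he, ← mApp_sub]; congr 1; abel
  have hγs : ∀ k, γ (k + 1) - γ k = mApp T (g (x (k + 1)) - g (x k)) := fun k => by
    simp only [hγ, ← mApp_sub]
  have hstep_e : ∀ k, e (k + 1) = e k - mApp (A k) (γ k) := fun k => by
    have h1 : mApp (A k) (γ k) = mApp sqH (mApp (H k) (g (x k))) := by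
      simp only [hA, hγ, ← mApp_mul]
      rw [Matrix.mul_assoc (sqH * H k), hST, Matrix.mul_one]
    rw [h1]
    simp only [he, hxup k, ← mApp_sub]
    congr 1; abel
  have hAup : ∀ k, A (k + 1) = bfgsUpdate (A k) (e (k + 1) - e k) (γ (k + 1) - γ k) := fun k => by
    have h1 : g (x (k + 1)) - g (x k) = mApp sqH (γ (k + 1) - γ k) := by
      rw [hγs, ← mApp_mul, hST, mApp_one]
    simp only [hA]
    rw [hHup k, h1, bfgsUpdate_conj hSt, hes]
  have hγdev : ∀ k, ‖γ k - e k‖ ≤ m * ‖e k‖ * ‖e k‖ := fun k => by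
    have h := hdev (a := x k) (b := xs) (R := ‖e k‖) le_rfl (by simp [mApp])
    simpa [hgxs] using h
  have hes0 : ∀ k, e (k + 1) - e k ≠ 0 := fun k h => by
    have h1 := hSlow (x (k + 1) - x k)
    rw [← hes, h, norm_zero] at h1
    have h2 := norm_pos_iff.2 (hsne k)
    nlinarith
  have hys : ∀ k, ‖e (k + 1)‖ ≤ ‖e k‖ →
      ‖(γ (k + 1) - γ k) - (e (k + 1) - e k)‖ ≤ m * ‖e k‖ * ‖e (k + 1) - e k‖ := fun k hk => by
    rw [hγs, hes]
    exact hdev hk le_rfl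
  have hx0' : m * √L * ‖x 0 - xs‖ ≤ min ε (δ / √d) := by
    have h := mul_le_mul_of_nonneg_left hx0 (by positivity : 0 ≤ m * √L)
    rw [hμ32] at h
    refine h.trans (le_of_eq ?_)
    rw [hm]; field_simp
  have hρ0 : m * ‖e 0‖ ≤ ε := by
    have h := mul_le_mul_of_nonneg_left (hSup (x 0 - xs)) hm0.le
    linarith [min_le_left ε (δ / √d)]
  have hn0 : frob (A 0 - 1) ≤ δ := by
    have hdet : IsUnit (Hess (x 0)).det := by
      have h := hH0pd.isUnit
      rw [hH0] at h
      exact (Matrix.isUnit_iff_isUnit_det _).1 (Matrix.isUnit_nonsing_inv_iff.1 h)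
    have hmul : H 0 * Hess (x 0) = 1 := by rw [hH0]; exact Matrix.nonsing_inv_mul _ hdet
    have hmul' : Hess (x 0) * H 0 = 1 := by rw [hH0]; exact Matrix.mul_nonsing_inv _ hdet
    have hH0n : ∀ v, μ * ‖mApp (H 0) v‖ ≤ ‖v‖ := fun v => by
      have h1 := hHl (x 0) (mApp (H 0) v)
      rw [← mApp_mul, hmul', mApp_one, dot_eq_inner] at h1
      have h2 := h1.trans (real_inner_le_norm _ _)
      rcases (norm_nonneg (mApp (H 0) v)).eq_or_lt with h3 | h3
      · rw [← h3]; simp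
      · nlinarith
    have hid : A 0 - 1 = sqH * H 0 * (Hess xs - Hess (x 0)) * T := by
      have h1 : sqH * H 0 * (Hess xs - Hess (x 0)) * T
          = sqH * H 0 * sqH * (sqH * T) - sqH * (H 0 * Hess (x 0)) * T := by
        rw [← hsqH2]; noncomm_ring
      rw [h1, hmul, hST, Matrix.mul_one, Matrix.mul_one, hST]
    have hspec : ∀ v, ‖mApp (Hess xs - Hess (x 0)) v‖ ≤ M * ‖x 0 - xs‖ * ‖v‖ := fun v => by
      have h1 : mApp (Hess xs - Hess (x 0)) v = -mApp (Hess (x 0) - Hess xs) v := by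
        rw [mApp_sub_left, mApp_sub_left]; abel
      rw [h1, norm_neg]
      exact (ContinuousLinearMap.le_opNorm _ v).trans
        (mul_le_mul_of_nonneg_right (hLip (x 0)) (norm_nonneg v))
    have hop : ∀ v, ‖mApp (A 0 - 1) v‖ ≤ m * √L * ‖x 0 - xs‖ * ‖v‖ := fun v => by
      rw [hid, mApp_mul, mApp_mul, mApp_mul]
      set v₁ := mApp T v
      set v₂ := mApp (Hess xs - Hess (x 0)) v₁
      have b1 : ‖v₁‖ ≤ ‖v‖ / √μ := by rw [le_div_iff₀ hμ', mul_comm]; exact hT v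
      have b3 : ‖mApp (H 0) v₂‖ ≤ ‖v₂‖ / μ := by rw [le_div_iff₀ hμ, mul_comm]; exact hH0n v₂
      calc ‖mApp sqH (mApp (H 0) v₂)‖ ≤ √L * ‖mApp (H 0) v₂‖ := hSup _
        _ ≤ √L * (M * ‖x 0 - xs‖ * (‖v‖ / √μ) / μ) := by
            gcongr
            refine b3.trans ?_
            gcongr
            exact (hspec v₁).trans (by gcongr)
        _ = _ := by rw [hm]; field_simp
    have h1 := frob_le_of_norm_mApp_le (A 0 - 1) (by positivity) hop
    refine h1.trans ?_
    calc √d * (m * √L * ‖x 0 - xs‖) ≤ √d * (δ / √d) := by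
          gcongr; exact hx0'.trans (min_le_right _ _)
      _ ≤ δ := by
          rcases eq_or_ne (√(d:ℝ)) 0 with h0 | h0
          · rw [h0]; simpa using hδ.le
          · rw [mul_div_cancel₀ _ h0]
  have hε1 : ε < 1 := by nlinarith [mul_pos hδ hε]
  have hε' : 0 < 1 - ε := by linarith
  have hr' : 0 < 1 - r := by linarith
  intro k hk
  have hmain := superlinear_of_recursion (ρ := fun k => ‖e k‖) (n := fun k => frob (A k - 1))
    (fun k => norm_nonneg _) (fun k => frob_nonneg _)
    (θ := fun k => ‖mApp (A k - 1) (γ (k + 1) - γ k)‖ / ‖γ (k + 1) - γ k‖)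
    (fun k => by positivity) hm0.le (by positivity)
    (by positivity : 0 ≤ (1 + ε) * (1 + r) / ((1 - ε) * (1 - r)))
    (by positivity : 0 ≤ (1 + r) / ((1 - ε) * (1 - r))) hε.le hδ.le hr0.le hr1 hc1 hn0 hρ0
    (fun k hnk hσk => by
      have h := bfgs_step (A k) hm0.le hε hδ hr1 hc2 (hstep_e k) (hes0 k) (hγdev k)
        (hγdev (k + 1)) (hys k) hnk hσk
      rw [← hAup k] at h
      exact h) hk
  have hcoef : (1 + ε) * (1 + r) / ((1 - ε) * (1 - r)) * (2 * √2 * δ * √k)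
        + (1 + r) / ((1 - ε) * (1 - r)) * (ε / (1 - r))
      ≤ 2 * √2 * δ * ((1 + ε) * (1 + r) / ((1 - ε) * (1 - r))) * √k
        + (1 + ε) * ε * (1 + r) / ((1 - ε) ^ 2 * (1 - r) ^ 2) := by
    have h1 : (1 + r) / ((1 - ε) * (1 - r)) * (ε / (1 - r))
        = (1 - ε) * (ε * (1 + r)) / ((1 - ε) ^ 2 * (1 - r) ^ 2) := by field_simp
    have h2 : (1 - ε) * (ε * (1 + r)) / ((1 - ε) ^ 2 * (1 - r) ^ 2)
        ≤ (1 + ε) * ε * (1 + r) / ((1 - ε) ^ 2 * (1 - r) ^ 2) := by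
      rw [mul_assoc (1 + ε)]; gcongr; linarith
    have h3 : (1 + ε) * (1 + r) / ((1 - ε) * (1 - r)) * (2 * √2 * δ * √k)
        = 2 * √2 * δ * ((1 + ε) * (1 + r) / ((1 - ε) * (1 - r))) * √k := by ring
    rw [h1, h3]
    linarith
  rw [Real.sqrt_div hL.le]
  set B := (2 * √2 * δ * ((1 + ε) * (1 + r) / ((1 - ε) * (1 - r))) * √k
        + (1 + ε) * ε * (1 + r) / ((1 - ε) ^ 2 * (1 - r) ^ 2)) / (k:ℝ) with hB
  have hB0 : 0 ≤ B := by positivity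
  have hek : ‖e k‖ ≤ B ^ k * ‖e 0‖ := by
    refine hmain.trans ?_
    gcongr
    exact div_le_div_of_nonneg_right hcoef (Nat.cast_nonneg k)
  have hfin : √μ * ‖x k - xs‖ ≤ B ^ k * (√L * ‖x 0 - xs‖) :=
    ((hSlow _).trans hek).trans (mul_le_mul_of_nonneg_left (hSup _) (by positivity))
  have hrw : √L / √μ * B ^ k * ‖x 0 - xs‖ = B ^ k * (√L * ‖x 0 - xs‖) / √μ := by ring
  rw [hrw, le_div_iff₀ hμ', mul_comm]
  exact hfin
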